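/- arXiv:1606.05539 — 3 statements merged into one kernel-verified Lean document; each statement's English description precedes it below -/
import Mathlib

section
/- Let f : X → Y be a map between pseudo-metric spaces. If X is large-scale geodesic and f is coarsely Lipschitz, then f is large-scale Lipschitz; i.e., there exist constants a > 0, b ≥ 0 with d(f(x),f(x')) ≤ a·d(x,x') + b for all x,x' ∈ X. -/
/-- A pseudo-metric space `X` is large-scale geodesic: there are `a > 0`, `b ≥ 0`,
`c > 0` such that any two points `x, y` are joined by a chain of at most
`a·d(x,y) + b` steps, each of length at most `c`. -/
def LargeScaleGeodesic (X : Type*) [PseudoMetricSpace X] : Prop :=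
  ∃ a b c : ℝ, 0 < a ∧ 0 ≤ b ∧ 0 < c ∧ ∀ x y : X, ∃ n : ℕ,
    (n : ℝ) ≤ a * dist x y + b ∧
    ∃ p : ℕ → X, p 0 = x ∧ p n = y ∧ ∀ i < n, dist (p i) (p (i + 1)) ≤ c

/-- A map between pseudo-metric spaces is coarsely Lipschitz if there is a
nondecreasing function `Φ₊` with `d(f(x),f(x')) ≤ Φ₊(d(x,x'))`. -/
def CoarselyLipschitz {X Y : Type*} [PseudoMetricSpace X] [PseudoMetricSpace Y]
    (f : X → Y) : Prop :=
  ∃ Φ : ℝ → ℝ, Monotone Φ ∧ ∀ x x' : X, dist (f x) (f x') ≤ Φ (dist x x')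

/-- a coarsely Lipschitz map defined on a large-scale geodesic
pseudo-metric space is large-scale Lipschitz. -/
theorem largeScaleLipschitz_of_coarselyLipschitz_of_largeScaleGeodesic
    {X Y : Type*} [PseudoMetricSpace X] [PseudoMetricSpace Y]
    (hX : LargeScaleGeodesic X) (f : X → Y) (hf : CoarselyLipschitz f) :
    ∃ a b : ℝ, 0 < a ∧ 0 ≤ b ∧ ∀ x x' : X, dist (f x) (f x') ≤ a * dist x x' + b := by
  obtain ⟨a, b, c, ha, hb, hc, h⟩ := hX
  obtain ⟨Φ, hΦ, hfΦ⟩ := hf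
  have hK : 0 < max (Φ c) 1 := lt_max_of_lt_right one_pos
  refine ⟨max (Φ c) 1 * a, max (Φ c) 1 * b, by positivity, by positivity, fun x x' => ?_⟩
  obtain ⟨n, hn, p, rfl, rfl, hp⟩ := h x x'
  have h1 : dist (f (p 0)) (f (p n)) ≤ ∑ i ∈ Finset.range n, max (Φ c) 1 :=
    dist_le_range_sum_of_dist_le (f := fun i => f (p i)) n
      (fun {k} hk => ((hfΦ _ _).trans (hΦ (hp k hk))).trans (le_max_left _ _))
  rw [Finset.sum_const, Finset.card_range, nsmul_eq_mul] at h1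
  have h2 := mul_le_mul_of_nonneg_left hn hK.le
  linarith
end

section
/- Let X and Y be uniformly locally finite metric spaces which are quasi-isometric. Then their uniform growth functions are asymptotically equivalent: b_X ≼ b_Y and b_Y ≼ b_X, where f ≼ g means there exist constants c, c', c'' > 0 with f(r) ≤ c·g(c'·r) + c'' for all r > 0. -/
/-- A subset `s` of a pseudo-metric space has diameter at most `r`. -/
def HasDiamLE {X : Type*} [PseudoMetricSpace X] (s : Set X) (r : ℝ) : Prop :=
  ∀ x ∈ s, ∀ y ∈ s, dist x y ≤ r

/-- A pseudo-metric space is uniformly locally finite (ULF): for every `r` there is a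
finite bound on the cardinality of subsets of diameter at most `r`. -/
def UniformlyLocallyFinite (X : Type*) [PseudoMetricSpace X] : Prop :=
  ∀ r : ℝ, ∃ N : ℕ, ∀ s : Set X, HasDiamLE s r → s.encard ≤ N

/-- The uniform growth function: `growth X r` is the supremum of the cardinalities of
subsets of `X` of diameter at most `r` (as a natural number; meaningful for ULF
spaces). -/
noncomputable def growth (X : Type*) [PseudoMetricSpace X] (r : ℝ) : ℕ :=
  sSup {n : ℕ | ∃ s : Set X, HasDiamLE s r ∧ s.encard = n}

/-- Essentially surjective map. -/
def EssentiallySurjective {X Y : Type*} [PseudoMetricSpace X] [PseudoMetricSpace Y]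
    (f : X → Y) : Prop :=
  ∃ C : ℝ, ∀ y : Y, ∃ x : X, dist y (f x) ≤ C

/-- Quasi-isometry: large-scale Lipschitz, large-scale expansive and essentially
surjective map. -/
def QuasiIsometry {X Y : Type*} [PseudoMetricSpace X] [PseudoMetricSpace Y]
    (f : X → Y) : Prop :=
  (∃ a b : ℝ, 0 < a ∧ 0 ≤ b ∧ ∀ x x' : X, dist (f x) (f x') ≤ a * dist x x' + b) ∧
  (∃ a b : ℝ, 0 < a ∧ 0 ≤ b ∧ ∀ x x' : X, a * dist x x' - b ≤ dist (f x) (f x')) ∧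
  EssentiallySurjective f

/-- `f ≼ g` : there are constants `c, c', c'' > 0` with `f(r) ≤ c·g(c'·r) + c''` for
all `r > 0`. -/
def GrowthPreceq (f g : ℝ → ℕ) : Prop :=
  ∃ c c' c'' : ℝ, 0 < c ∧ 0 < c' ∧ 0 < c'' ∧ ∀ r : ℝ, 0 < r →
    (f r : ℝ) ≤ c * (g (c' * r) : ℝ) + c''

theorem le_growth_aux {X : Type*} [PseudoMetricSpace X] (hX : UniformlyLocallyFinite X)
    (r : ℝ) (s : Finset X) (hs : HasDiamLE (s : Set X) r) : s.card ≤ growth X r := by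
  obtain ⟨N, hN⟩ := hX r
  unfold growth
  apply le_csSup
  · refine ⟨N, ?_⟩
    rintro n ⟨t, ht, hn⟩
    have := hN t ht
    rw [hn] at this
    exact_mod_cast this
  · exact ⟨s, hs, Set.encard_coe_eq_coe_finsetCard s⟩

theorem growth_le_aux {X : Type*} [PseudoMetricSpace X]
    (r : ℝ) (M : ℕ) (h : ∀ s : Finset X, HasDiamLE (s : Set X) r → s.card ≤ M) :
    growth X r ≤ M := by
  unfold growth
  apply csSup_le'
  rintro n ⟨t, ht, hn⟩
  have hfin : t.Finite := Set.finite_of_encard_eq_coe hn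
  lift t to Finset X using hfin
  rw [Set.encard_coe_eq_coe_finsetCard] at hn
  have hn' : t.card = n := by exact_mod_cast hn
  rw [← hn']
  exact h t ht

theorem growth_preceq_aux {X Y : Type*} [PseudoMetricSpace X] [PseudoMetricSpace Y]
    (hX : UniformlyLocallyFinite X) (hY : UniformlyLocallyFinite Y) (g : X → Y)
    (a b D : ℝ) (ha : 0 < a) (hb : 0 ≤ b)
    (hg : ∀ x x' : X, dist (g x) (g x') ≤ a * dist x x' + b)
    (hD : ∀ x x' : X, g x = g x' → dist x x' ≤ D) :
    GrowthPreceq (growth X) (growth Y) := by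
  classical
  refine ⟨growth X D + 1, a + b, growth X 1 + 1, by positivity, by positivity, by positivity, ?_⟩
  intro r hr
  rcases le_total r 1 with h1 | h1
  · have h : growth X r ≤ growth X 1 := growth_le_aux r _ fun s hs =>
      le_growth_aux hX 1 s fun x hx y hy => (hs x hx y hy).trans h1
    have h' : (growth X r : ℝ) ≤ growth X 1 := by exact_mod_cast h
    have : (0 : ℝ) ≤ (growth X D + 1) * (growth Y ((a + b) * r) : ℝ) := by positivity
    linarith
  · have h : growth X r ≤ growth X D * growth Y ((a + b) * r) := by
      refine growth_le_aux r _ fun s hs => ?_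
      refine (Finset.card_le_mul_card_image (f := g) s (growth X D) ?_).trans
        (Nat.mul_le_mul_left _ ?_)
      · intro y _
        refine le_growth_aux hX D _ ?_
        intro x hx x' hx'
        simp only [Finset.coe_filter, Set.mem_setOf_eq] at hx hx'
        exact hD x x' (hx.2.trans hx'.2.symm)
      · refine le_growth_aux hY _ _ ?_
        intro y hy y' hy'
        simp only [Finset.coe_image, Set.mem_image] at hy hy'
        obtain ⟨x, hx, rfl⟩ := hy
        obtain ⟨x', hx', rfl⟩ := hy'
        have h2 := hs x hx x' hx'
        have h3 := hg x x'
        nlinarith [mul_le_mul_of_nonneg_left h2 ha.le, mul_le_mul_of_nonneg_left h1 hb]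
    have h' : (growth X r : ℝ) ≤ growth X D * growth Y ((a + b) * r) := by exact_mod_cast h
    have h4 : (0 : ℝ) ≤ growth Y ((a + b) * r) := by positivity
    have h5 : (0 : ℝ) ≤ growth X 1 := by positivity
    linarith

/-- quasi-isometric uniformly locally finite metric spaces have
asymptotically equivalent uniform growth functions. -/
theorem growth_asymptotically_equivalent_of_quasiIsometry
    {X Y : Type*} [MetricSpace X] [MetricSpace Y]
    (hX : UniformlyLocallyFinite X) (hY : UniformlyLocallyFinite Y)
    (f : X → Y) (hf : QuasiIsometry f) :
    GrowthPreceq (growth X) (growth Y) ∧ GrowthPreceq (growth Y) (growth X) := by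
  obtain ⟨⟨a, b, ha, hb, hab⟩, ⟨a', b', ha', hb', hab'⟩, C, hC⟩ := hf
  constructor
  · refine growth_preceq_aux hX hY f a b (b' / a') ha hb hab ?_
    intro x x' h
    have := hab' x x'
    rw [h, dist_self] at this
    rw [le_div_iff₀ ha']
    linarith
  · choose g hg using hC
    refine growth_preceq_aux hY hX g (1 / a') ((2 * |C| + b') / a') (2 * |C|)
      (by positivity) (by positivity) ?_ ?_
    · intro y y'
      have h1 := hab' (g y) (g y')
      have h2 := dist_triangle4 (f (g y)) y y' (f (g y'))
      have h3 := hg y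
      have h4 := hg y'
      rw [dist_comm] at h3
      have h5 := le_abs_self C
      have h6 : 1 / a' * dist y y' + (2 * |C| + b') / a' = (dist y y' + (2 * |C| + b')) / a' := by
        ring
      rw [h6, le_div_iff₀ ha']
      linarith
    · intro y y' h
      have h3 := hg y
      have h4 := hg y'
      rw [← h] at h4
      have h5 := le_abs_self C
      have h6 := dist_triangle_right y y' (f (g y))
      linarith
end

section
/- A pseudo-metric space X is uniformly coarsely proper if and only if X is quasi-isometric to a uniformly locally finite metric space. -/
/-- A pseudo-metric space is uniformly coarsely proper: there are a nondecreasing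
`Ψ : ℝ → ℝ` and `r₀ > 0` such that, for every `r ≥ r₀`, every subset of diameter at
most `r` is covered by at most `Ψ(r)` subsets of diameter at most `r₀`. -/
def UniformlyCoarselyProper (X : Type*) [PseudoMetricSpace X] : Prop :=
  ∃ Ψ : ℝ → ℝ, Monotone Ψ ∧ ∃ r₀ : ℝ, 0 < r₀ ∧ ∀ r : ℝ, r₀ ≤ r →
    ∀ s : Set X, HasDiamLE s r →
      ∃ c : Finset (Set X), (c.card : ℝ) ≤ Ψ r ∧ (∀ t ∈ c, HasDiamLE t r₀) ∧
        s ⊆ ⋃ t ∈ c, t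

theorem ULF_mono_bound {Y : Type*} [PseudoMetricSpace Y] (h : UniformlyLocallyFinite Y) :
    ∃ N : ℝ → ℕ, Monotone N ∧ ∀ r, ∀ s : Set Y, HasDiamLE s r → s.encard ≤ N r := by
  classical
  refine ⟨fun r => Nat.find (h r), ?_, fun r => Nat.find_spec (h r)⟩
  intro r r' hr
  refine Nat.find_min' (h r) ?_
  intro s hs
  exact Nat.find_spec (h r') s (fun x hx y hy => (hs x hx y hy).trans hr)

theorem exists_net (X : Type*) [PseudoMetricSpace X] (r : ℝ) (hr : 0 < r) :
    ∃ L : Set X, (∀ x ∈ L, ∀ y ∈ L, dist x y ≤ r → x = y) ∧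
      ∀ x, ∃ y ∈ L, dist x y ≤ r := by
  obtain ⟨L, hL⟩ := zorn_subset {S : Set X | S.Pairwise fun x y => r < dist x y} (by
    intro c hc hchain
    refine ⟨⋃₀ c, ?_, fun s hs => Set.subset_sUnion_of_mem hs⟩
    exact (Set.pairwise_sUnion hchain.directedOn).2 fun s hs => hc hs)
  refine ⟨L, ?_, ?_⟩
  · intro x hx y hy hxy
    by_contra hne
    exact absurd (hL.prop hx hy hne) (not_lt.2 hxy)
  · intro x
    by_contra! hcon
    have hins : (insert x L).Pairwise fun x y => r < dist x y := by
      refine (Set.pairwise_insert).2 ⟨hL.prop, fun y hy _ => ⟨hcon y hy, ?_⟩⟩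
      rw [dist_comm]
      exact hcon y hy
    have hx : x ∈ L := hL.le_of_ge hins (Set.subset_insert x L) (Set.mem_insert x L)
    have := hcon x hx
    rw [dist_self] at this
    exact absurd this (not_lt.2 hr.le)

/-- a pseudo-metric space is uniformly coarsely proper if and only if it
is quasi-isometric to a uniformly locally finite metric space. -/
theorem uniformlyCoarselyProper_iff_quasiIsometric_to_ULF
    {X : Type u} [PseudoMetricSpace X] :
    UniformlyCoarselyProper X ↔
      ∃ (Y : Type u) (m : MetricSpace Y),
        letI := m
        UniformlyLocallyFinite Y ∧ ∃ f : X → Y, QuasiIsometry f := by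
  constructor
  · rintro ⟨Ψ, hΨ, r₀, hr₀, H⟩
    obtain ⟨L, hsep, hnet⟩ := exists_net X r₀ hr₀
    choose g hgL hg using hnet
    let m : MetricSpace L :=
      { (inferInstance : PseudoMetricSpace L) with
        eq_of_dist_eq_zero := by
          intro x y hxy
          have hxy' : dist (x : X) (y : X) = 0 := hxy
          exact Subtype.ext (hsep x x.2 y y.2 (by rw [hxy']; exact hr₀.le)) }
    refine ⟨L, m, ?_, fun x => ⟨g x, hgL x⟩, ?_, ?_, ?_⟩
    · intro r
      refine ⟨⌊Ψ (max r r₀)⌋₊, ?_⟩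
      intro s hs
      obtain ⟨c, hc, hct, hcov⟩ := H (max r r₀) (le_max_right _ _) (Subtype.val '' s) (by
        rintro _ ⟨x, hx, rfl⟩ _ ⟨y, hy, rfl⟩
        exact le_trans (hs x hx y hy) (le_max_left _ _))
      have hex : ∀ x : L, ∃ t : Set X, x ∈ s → t ∈ c ∧ (x : X) ∈ t := by
        intro x
        by_cases hx : x ∈ s
        · have := hcov ⟨x, hx, rfl⟩
          simp only [Set.mem_iUnion] at this
          obtain ⟨t, ht, hxt⟩ := this
          exact ⟨t, fun _ => ⟨ht, hxt⟩⟩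
        · exact ⟨∅, fun h => absurd h hx⟩
      choose T hT using hex
      have hinj : Set.InjOn T s := by
        intro x hx y hy hxy
        have h1 := (hT x hx)
        have h2 := (hT y hy)
        rw [← hxy] at h2
        exact Subtype.ext (hsep x x.2 y y.2 (hct _ h1.1 _ h1.2 _ h2.2))
      have hle : s.encard ≤ (c : Set (Set X)).encard :=
        Set.encard_le_encard_of_injOn (fun x hx => (hT x hx).1) hinj
      rw [Set.encard_coe_eq_coe_finsetCard] at hle
      refine hle.trans ?_
      exact_mod_cast Nat.le_floor hc
    · refine ⟨1, 2 * r₀, one_pos, by positivity, fun x x' => ?_⟩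
      change dist (g x) (g x') ≤ _
      have h1 := dist_triangle4 (g x) x x' (g x')
      have h2 := hg x
      have h3 := hg x'
      rw [dist_comm] at h2
      linarith
    · refine ⟨1, 2 * r₀, one_pos, by positivity, fun x x' => ?_⟩
      change _ ≤ dist (g x) (g x')
      have h1 := dist_triangle4 x (g x) (g x') x'
      have h2 := hg x
      have h3 := hg x'
      rw [dist_comm] at h3
      linarith
    · exact ⟨r₀, fun y => ⟨y, hg y⟩⟩
  · rintro ⟨Y, m, hY, f, ⟨a, b, ha, hb, hf⟩, ⟨a', b', ha', hb', hf'⟩, -⟩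
    obtain ⟨N, hN, hNs⟩ := ULF_mono_bound hY
    classical
    refine ⟨fun r => N (a * r + b), ?_, b' / a' + 1, by positivity, ?_⟩
    · intro r r' hr
      have : N (a * r + b) ≤ N (a * r' + b) := hN (by gcongr)
      exact Nat.cast_le.2 this
    · intro r hr s hs
      have hcard := hNs (a * r + b) (f '' s) (by
        rintro _ ⟨x, hx, rfl⟩ _ ⟨y, hy, rfl⟩
        have := mul_le_mul_of_nonneg_left (hs x hx y hy) ha.le
        linarith [hf x y])
      have hfin : (f '' s).Finite := Set.finite_of_encard_le_coe hcard
      rw [hfin.encard_eq_coe_toFinset_card] at hcard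
      refine ⟨hfin.toFinset.image (fun y => f ⁻¹' {y}), ?_, ?_, ?_⟩
      · have h1 : hfin.toFinset.card ≤ N (a * r + b) := by exact_mod_cast hcard
        exact Nat.cast_le.2 (Finset.card_image_le.trans h1)
      · intro t ht
        obtain ⟨y, -, rfl⟩ := Finset.mem_image.1 ht
        intro x hx x' hx'
        have hx1 : f x = y := hx
        have hx2 : f x' = y := hx'
        have h := hf' x x'
        rw [hx1, hx2, dist_self] at h
        have : dist x x' ≤ b' / a' := by
          rw [le_div_iff₀ ha']
          linarith
        linarith
      · intro x hx
        simp only [Set.mem_iUnion]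
        exact ⟨f ⁻¹' {f x}, Finset.mem_image.2 ⟨f x, hfin.mem_toFinset.2 ⟨x, hx, rfl⟩, rfl⟩, rfl⟩
end
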